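/- Let S be an N×N matrix over ℂ with diagonalization S = V · diag(λ) · V⁻¹, where V is invertible and the entries of λ ∈ ℂ^N are pairwise distinct. Let X and Y be N×M complex matrices such that every row of V⁻¹·X has at least one nonzero entry, and let γ > 0. Then for every real number α, the sublevel set {H ∈ ℂ^{N×N} : ‖Y − H·X‖_F² + γ·‖S·H − H·S‖_F² ≤ α} is compact. -/

import Mathlib

/-- Squared Frobenius norm of a complex matrix: `Σ_{i,j} |M_{ij}|²`. -/
noncomputable def frobSq {n m : Type*} [Fintype n] [Fintype m] (M : Matrix n m ℂ) : ℝ :=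
  ∑ i, ∑ j, ‖M i j‖ ^ 2

theorem frobSq_nonneg' {n m : Type*} [Fintype n] [Fintype m] (A : Matrix n m ℂ) :
    0 ≤ frobSq A := by
  unfold frobSq; positivity

theorem entry_le_frobSq {n m : Type*} [Fintype n] [Fintype m] (A : Matrix n m ℂ) (i : n) (j : m) :
    ‖A i j‖ ^ 2 ≤ frobSq A := by
  unfold frobSq
  calc ‖A i j‖ ^ 2 ≤ ∑ j, ‖A i j‖ ^ 2 :=
        Finset.single_le_sum (f := fun j => ‖A i j‖ ^ 2) (fun _ _ => by positivity)
          (Finset.mem_univ j)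
    _ ≤ _ := Finset.single_le_sum (f := fun i => ∑ j, ‖A i j‖ ^ 2) (fun _ _ => by positivity)
          (Finset.mem_univ i)

theorem continuous_frobSq {n m : Type*} [Fintype n] [Fintype m] :
    Continuous (frobSq : Matrix n m ℂ → ℝ) := by
  unfold frobSq
  refine continuous_finsetSum _ fun i _ => continuous_finsetSum _ fun j _ => ?_
  exact ((continuous_id.matrix_elem i j).norm).pow 2

theorem isCompact_target {n m k l : Type*} [Fintype n] [Fintype m] [Fintype k] [Fintype l]
    (Y : Matrix n m ℂ) (γ : ℝ) (hγ : 0 < γ) (α : ℝ) :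
    IsCompact {p : Matrix n m ℂ × Matrix k l ℂ | frobSq (Y - p.1) + γ * frobSq p.2 ≤ α} := by
  have h1 : IsCompact (Set.univ.pi fun i => Set.univ.pi fun j =>
      Metric.closedBall (Y i j) (Real.sqrt α) : Set (n → m → ℂ)) :=
    isCompact_univ_pi fun i => isCompact_univ_pi fun j => isCompact_closedBall _ _
  have h2 : IsCompact (Set.univ.pi fun i => Set.univ.pi fun j =>
      Metric.closedBall (0 : ℂ) (Real.sqrt (α / γ)) : Set (k → l → ℂ)) :=
    isCompact_univ_pi fun i => isCompact_univ_pi fun j => isCompact_closedBall _ _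
  refine IsCompact.of_isClosed_subset (h1.prod h2) ?_ ?_
  · exact isClosed_le ((continuous_frobSq.comp (continuous_const.sub continuous_fst)).add
      (continuous_const.mul (continuous_frobSq.comp continuous_snd))) continuous_const
  · rintro ⟨A, B⟩ h
    simp only [Set.mem_setOf_eq] at h
    have hA := frobSq_nonneg' (Y - A)
    have hB := mul_nonneg hγ.le (frobSq_nonneg' B)
    refine ⟨fun i _ j _ => ?_, fun i _ j _ => ?_⟩
    · rw [Metric.mem_closedBall, dist_comm, dist_eq_norm]
      apply Real.le_sqrt_of_sq_le
      have := entry_le_frobSq (Y - A) i j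
      rw [Matrix.sub_apply] at this
      exact this.trans (by linarith)
    · rw [Metric.mem_closedBall, dist_zero_right]
      apply Real.le_sqrt_of_sq_le
      refine (entry_le_frobSq B i j).trans ?_
      rw [le_div_iff₀ hγ]
      linarith

/-- The linear map `H ↦ (H X, S H - H S)`. -/
noncomputable def objMap {N M : ℕ} (S : Matrix (Fin N) (Fin N) ℂ) (X : Matrix (Fin N) (Fin M) ℂ) :
    Matrix (Fin N) (Fin N) ℂ →ₗ[ℂ] Matrix (Fin N) (Fin M) ℂ × Matrix (Fin N) (Fin N) ℂ where
  toFun H := (H * X, S * H - H * S)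
  map_add' A B := by
    ext : 1
    · simp [Matrix.add_mul]
    · simp only [Matrix.add_mul, Matrix.mul_add, Prod.snd_add]; abel
  map_smul' c A := by
    ext : 1 <;> simp [smul_sub]

theorem objMap_ker {N M : ℕ} (S V : Matrix (Fin N) (Fin N) ℂ) (hV : IsUnit V)
    (lam : Fin N → ℂ) (hlam : Function.Injective lam)
    (hS : S = V * Matrix.diagonal lam * V⁻¹)
    (X : Matrix (Fin N) (Fin M) ℂ) (hX : ∀ i : Fin N, ∃ m : Fin M, (V⁻¹ * X) i m ≠ 0) :
    LinearMap.ker (objMap S X) = ⊥ := by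
  rw [LinearMap.ker_eq_bot']
  intro H hH
  have hdet : IsUnit V.det := (Matrix.isUnit_iff_isUnit_det V).1 hV
  have e1 : V⁻¹ * V = 1 := Matrix.nonsing_inv_mul V hdet
  have e2 : V * V⁻¹ = 1 := Matrix.mul_nonsing_inv V hdet
  have h1 : H * X = 0 := congrArg Prod.fst hH
  have h2 : S * H - H * S = 0 := congrArg Prod.snd hH
  rw [sub_eq_zero] at h2
  obtain ⟨D, hD⟩ : ∃ D, D = V⁻¹ * H * V := ⟨_, rfl⟩
  have hHD : H = V * D * V⁻¹ := by
    calc H = (V * V⁻¹) * H * (V * V⁻¹) := by rw [e2]; simp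
      _ = _ := by rw [hD]; simp only [Matrix.mul_assoc]
  have hc : Matrix.diagonal lam * D = D * Matrix.diagonal lam := by
    calc Matrix.diagonal lam * D
        = (V⁻¹ * V) * Matrix.diagonal lam * V⁻¹ * H * V := by
          rw [e1, hD]; simp only [Matrix.mul_assoc, Matrix.one_mul]
      _ = V⁻¹ * (S * H) * V := by rw [hS]; simp only [Matrix.mul_assoc]
      _ = V⁻¹ * (H * S) * V := by rw [h2]
      _ = V⁻¹ * H * V * Matrix.diagonal lam * (V⁻¹ * V) := by
          rw [hS]; simp only [Matrix.mul_assoc]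
      _ = _ := by rw [e1, hD, Matrix.mul_one]
  have hoff : ∀ i j, i ≠ j → D i j = 0 := by
    intro i j hij
    have := congrFun (congrFun hc i) j
    rw [Matrix.diagonal_mul, Matrix.mul_diagonal] at this
    have h3 : (lam i - lam j) * D i j = 0 := by linear_combination this
    exact (mul_eq_zero.1 h3).resolve_left (sub_ne_zero.2 fun h => hij (hlam h))
  have hDX : D * (V⁻¹ * X) = 0 := by
    calc D * (V⁻¹ * X) = V⁻¹ * H * (V * V⁻¹) * X := by
          rw [hD]; simp only [Matrix.mul_assoc]
      _ = V⁻¹ * (H * X) := by rw [e2]; simp only [Matrix.mul_assoc, Matrix.mul_one]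
      _ = 0 := by rw [h1, Matrix.mul_zero]
  have hD0 : D = 0 := by
    ext i j
    by_cases hij : i = j
    · subst hij
      obtain ⟨m, hm⟩ := hX i
      have := congrFun (congrFun hDX i) m
      rw [Matrix.mul_apply, Finset.sum_eq_single i (fun b _ hb => by
        rw [hoff i b hb.symm, zero_mul]) (by simp)] at this
      exact (mul_eq_zero.1 this).resolve_right hm
    · exact hoff i j hij
  rw [hHD, hD0]; simp

/-- Under the hypotheses of Proposition 1, every sublevel set of the objective
`H ↦ ‖Y − H X‖_F² + γ ‖S H − H S‖_F²` is compact. -/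
theorem statement10 {N M : ℕ} (S V : Matrix (Fin N) (Fin N) ℂ) (hV : IsUnit V)
    (lam : Fin N → ℂ) (hlam : Function.Injective lam)
    (hS : S = V * Matrix.diagonal lam * V⁻¹)
    (X Y : Matrix (Fin N) (Fin M) ℂ) (hX : ∀ i : Fin N, ∃ m : Fin M, (V⁻¹ * X) i m ≠ 0)
    (γ : ℝ) (hγ : 0 < γ) (α : ℝ) :
    IsCompact {H : Matrix (Fin N) (Fin N) ℂ |
      frobSq (Y - H * X) + γ * frobSq (S * H - H * S) ≤ α} := by
  have hemb := LinearMap.isClosedEmbedding_of_injective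
    (objMap_ker S V hV lam hlam hS X hX)
  exact hemb.isCompact_preimage (isCompact_target Y γ hγ α)
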